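/- Let 𝓔, 𝓔' be i.i.d. standard exponential random variables and let G be a standard Gaussian random variable independent of 𝓔. Then 𝓔 − 𝓔' and √(2𝓔)·G have the same distribution (namely the symmetric exponential/Laplace distribution with density (1/2)e^{-|x|}). -/

import Mathlib

open MeasureTheory ProbabilityTheory

lemma expMeasure_integral_aux (f : ℝ → ℂ) :
    ∫ x, f x ∂(expMeasure 1) = ∫ x in Set.Ioi (0:ℝ), Complex.exp (-x) * f x := by
  have h1 : expMeasure 1 = volume.withDensity (exponentialPDF 1) := rfl
  rw [h1, integral_withDensity_eq_integral_toReal_smul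
    (show Measurable (exponentialPDF 1) from
      (measurable_exponentialPDFReal 1).ennreal_ofReal)
    (Filter.Eventually.of_forall fun x => ENNReal.ofReal_lt_top),
    ← integral_Ici_eq_integral_Ioi, ← integral_indicator measurableSet_Ici]
  congr 1
  ext x
  by_cases hx : 0 ≤ x
  · rw [Set.indicator_of_mem (by exact hx), exponentialPDF_of_nonneg hx,
      ENNReal.toReal_ofReal (by positivity)]
    simp
  · rw [Set.indicator_of_notMem (by exact hx), exponentialPDF_of_neg (not_le.mp hx)]
    simp

lemma expMeasure_integral_cexp (a : ℂ) (ha : a.re < 1) :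
    ∫ x : ℝ, Complex.exp (a * x) ∂(expMeasure 1) = 1 / (1 - a) := by
  rw [expMeasure_integral_aux]
  have h := integral_exp_mul_complex_Ioi (a := a - 1) (by simpa using ha) 0
  have h2 : ∀ x : ℝ, Complex.exp (-x) * Complex.exp (a * x) = Complex.exp ((a - 1) * x) := by
    intro x
    rw [← Complex.exp_add]
    congr 1
    ring
  simp_rw [h2]
  rw [h]
  simp only [Complex.ofReal_zero, mul_zero, Complex.exp_zero]
  rw [← neg_sub a 1, neg_div, div_neg]

lemma charFun_expMeasure_one (t : ℝ) :
    charFun (expMeasure 1) t = 1 / (1 - t * Complex.I) := by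
  rw [charFun_apply_real, ← expMeasure_integral_cexp (t * Complex.I) (by simp)]
  congr 1
  ext x
  congr 1
  ring

lemma one_sub_mul_I_ne (t : ℝ) : (1 : ℂ) - t * Complex.I ≠ 0 := by
  intro h
  simpa using congrArg Complex.re h

lemma one_add_mul_I_ne (t : ℝ) : (1 : ℂ) + t * Complex.I ≠ 0 := by
  intro h
  simpa using congrArg Complex.re h

lemma one_add_sq_eq (t : ℝ) :
    (1 : ℂ) + t ^ 2 = (1 - t * Complex.I) * (1 + t * Complex.I) := by
  linear_combination ((t : ℂ) ^ 2) * Complex.I_sq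

lemma integrable_exp_neg_abs_aux : Integrable (fun x : ℝ => Real.exp (-|x|)) := by
  rw [← integrableOn_univ, ← Set.Iic_union_Ioi (a := (0:ℝ))]
  refine IntegrableOn.union ?_ ?_
  · refine (integrableOn_exp_Iic 0).congr_fun (fun x hx => ?_) measurableSet_Iic
    rw [abs_of_nonpos hx, neg_neg]
  · refine (integrableOn_exp_neg_Ioi 0).congr_fun (fun x hx => ?_) measurableSet_Ioi
    rw [abs_of_pos hx]

lemma laplace_integrable : Integrable (fun x : ℝ => (1 / 2) * Real.exp (-|x|)) := by
  have := integrable_exp_neg_abs_aux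
  exact this.const_mul _

lemma charFun_laplace (t : ℝ) :
    charFun (volume.withDensity (fun x : ℝ => ENNReal.ofReal ((1 / 2) * Real.exp (-|x|)))) t
      = 1 / (1 + t ^ 2) := by
  rw [charFun_apply_real, integral_withDensity_eq_integral_toReal_smul
    (by fun_prop)
    (Filter.Eventually.of_forall fun x => ENNReal.ofReal_lt_top)]
  have hI : Integrable (fun x : ℝ => (ENNReal.ofReal ((1 / 2) * Real.exp (-|x|))).toReal •
      Complex.exp (t * x * Complex.I)) := by
    refine laplace_integrable.mono' (by fun_prop) (Filter.Eventually.of_forall fun x => ?_)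
    rw [norm_smul, ENNReal.toReal_ofReal (by positivity)]
    have : ‖Complex.exp (t * x * Complex.I)‖ = 1 := by
      exact_mod_cast Complex.norm_exp_ofReal_mul_I (t * x)
    rw [this, mul_one, Real.norm_of_nonneg (by positivity)]
  rw [← intervalIntegral.integral_Iic_add_Ioi (b := 0) hI.integrableOn hI.integrableOn]
  have e1 : ∫ x in Set.Iic (0:ℝ), (ENNReal.ofReal ((1 / 2) * Real.exp (-|x|))).toReal •
      Complex.exp (t * x * Complex.I) = 1 / 2 * (1 / (1 + t * Complex.I)) := by
    have h := integral_exp_mul_complex_Iic (a := 1 + t * Complex.I) (by simp) 0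
    simp only [Complex.ofReal_zero, mul_zero, Complex.exp_zero] at h
    rw [← h, ← integral_const_mul]
    refine setIntegral_congr_fun measurableSet_Iic fun x hx => ?_
    rw [ENNReal.toReal_ofReal (by positivity), abs_of_nonpos hx, Complex.real_smul]
    push_cast
    rw [mul_assoc, ← Complex.exp_add]
    congr 2
    ring
  have e2 : ∫ x in Set.Ioi (0:ℝ), (ENNReal.ofReal ((1 / 2) * Real.exp (-|x|))).toReal •
      Complex.exp (t * x * Complex.I) = 1 / 2 * (1 / (1 - t * Complex.I)) := by
    have h := integral_exp_mul_complex_Ioi (a := t * Complex.I - 1) (by simp) 0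
    simp only [Complex.ofReal_zero, mul_zero, Complex.exp_zero] at h
    rw [← neg_sub, div_neg, ← neg_div, ← h, ← integral_const_mul]
    refine setIntegral_congr_fun measurableSet_Ioi fun x hx => ?_
    rw [ENNReal.toReal_ofReal (by positivity), abs_of_pos hx, Complex.real_smul]
    push_cast
    rw [mul_assoc, ← Complex.exp_add]
    congr 2
    ring
  rw [e1, e2, one_add_sq_eq]
  have := one_sub_mul_I_ne t
  have := one_add_mul_I_ne t
  field_simp
  ring

/-- **The symmetric exponential is a Gaussian mixture**: if `𝓔, 𝓔'` are i.i.d. standard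
exponentials and `G` is a standard Gaussian independent of `𝓔`, then `𝓔 - 𝓔'` and
`√(2𝓔)·G` have the same distribution — the Laplace distribution with density
`(1/2)e^{-|x|}`. -/
theorem symm_exponential_gaussian_mixture
    {Ω : Type*} [MeasurableSpace Ω] (μ : Measure Ω) [IsProbabilityMeasure μ]
    (E E' G : Ω → ℝ) (hE : Measurable E) (hE' : Measurable E') (hG : Measurable G)
    (hlawE : Measure.map E μ = expMeasure 1) (hlawE' : Measure.map E' μ = expMeasure 1)
    (hEE' : IndepFun E E' μ) (hlawG : Measure.map G μ = gaussianReal 0 1)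
    (hEG : IndepFun E G μ) :
    Measure.map (fun ω => E ω - E' ω) μ
        = Measure.map (fun ω => Real.sqrt (2 * E ω) * G ω) μ
    ∧ Measure.map (fun ω => E ω - E' ω) μ
        = volume.withDensity (fun x => ENNReal.ofReal ((1 / 2) * Real.exp (-|x|))) := by
  have : IsProbabilityMeasure (expMeasure 1) := isProbabilityMeasure_expMeasure one_pos
  have : IsFiniteMeasure
      (volume.withDensity (fun x : ℝ => ENNReal.ofReal ((1 / 2) * Real.exp (-|x|)))) :=
    isFiniteMeasure_withDensity_ofReal laplace_integrable.2
  have hprob : ∀ f : Ω → ℝ, Measurable f → IsFiniteMeasure (Measure.map f μ) := fun f hf =>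
    inferInstance
  have hsub : ∀ t : ℝ, charFun (Measure.map (fun ω => E ω - E' ω) μ) t = 1 / (1 + t ^ 2) := by
    intro t
    have hind : IndepFun E (fun ω => (-1 : ℝ) * E' ω) μ :=
      hEE'.comp measurable_id (measurable_const_mul (-1 : ℝ))
    have he : (fun ω => E ω - E' ω) = E + fun ω => (-1 : ℝ) * E' ω := by
      ext ω
      simp [sub_eq_add_neg]
    rw [he, hind.charFun_map_add_eq_mul hE.aemeasurable (by fun_prop), Pi.mul_apply,
      charFun_map_mul_comp hE'.aemeasurable, hlawE, hlawE', charFun_expMeasure_one,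
      charFun_expMeasure_one, one_add_sq_eq]
    push_cast
    rw [div_mul_div_comm]
    ring_nf
  have hmix : ∀ t : ℝ,
      charFun (Measure.map (fun ω => Real.sqrt (2 * E ω) * G ω) μ) t = 1 / (1 + t ^ 2) := by
    intro t
    have hp := (indepFun_iff_map_prod_eq_prod_map_map hE.aemeasurable hG.aemeasurable).1 hEG
    rw [hlawE, hlawG] at hp
    have hm : Measurable fun p : ℝ × ℝ => Real.sqrt (2 * p.1) * p.2 := by fun_prop
    have he : Measure.map (fun ω => Real.sqrt (2 * E ω) * G ω) μ
        = Measure.map (fun p : ℝ × ℝ => Real.sqrt (2 * p.1) * p.2)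
          ((expMeasure 1).prod (gaussianReal 0 1)) := by
      rw [← hp, Measure.map_map hm (hE.prodMk hG)]
      rfl
    have hI : Integrable (fun p : ℝ × ℝ =>
        Complex.exp (t * (Real.sqrt (2 * p.1) * p.2 : ℝ) * Complex.I))
        ((expMeasure 1).prod (gaussianReal 0 1)) := by
      refine (integrable_const (1 : ℝ)).mono' (by fun_prop)
        (Filter.Eventually.of_forall fun p => ?_)
      rw [← Complex.ofReal_mul, Complex.norm_exp_ofReal_mul_I]
    rw [he, charFun_apply_real, integral_map hm.aemeasurable (by fun_prop),
      integral_prod _ hI]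
    have hin : ∀ x : ℝ, ∫ y, Complex.exp (t * (Real.sqrt (2 * x) * y : ℝ) * Complex.I)
        ∂(gaussianReal 0 1) = Complex.exp (-((t * Real.sqrt (2 * x)) ^ 2 / 2 : ℝ)) := by
      intro x
      have h := charFun_gaussianReal (μ := 0) (v := 1) (t * Real.sqrt (2 * x))
      rw [charFun_apply_real] at h
      convert h using 2
      · ext y
        push_cast
        ring_nf
      · push_cast
        ring_nf
    simp_rw [hin]
    have hfin := expMeasure_integral_cexp (-(t : ℂ) ^ 2) (by
      have : (-(t : ℂ) ^ 2) = ((-t ^ 2 : ℝ) : ℂ) := by push_cast; rfl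
      rw [this, Complex.ofReal_re]
      nlinarith [sq_nonneg t])
    rw [sub_neg_eq_add] at hfin
    rw [← hfin, expMeasure_integral_aux, expMeasure_integral_aux]
    refine setIntegral_congr_fun measurableSet_Ioi fun x hx => ?_
    have hx' : (0 : ℝ) ≤ 2 * x := by
      have : (0 : ℝ) < x := hx
      positivity
    rw [mul_pow, Real.sq_sqrt hx']
    push_cast
    ring_nf
  have := hprob _ (hE.sub hE')
  have := hprob (fun ω => Real.sqrt (2 * E ω) * G ω) (by fun_prop)
  refine ⟨Measure.ext_of_charFun ?_, Measure.ext_of_charFun ?_⟩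
  · ext t
    rw [hsub, hmix]
  · ext t
    rw [hsub, charFun_laplace]
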